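/- Let X and Y be compact metric spaces and let π : X → Y be a homeomorphism such that d_Y(π(a), π(b)) ≥ c · d_X(a,b)^K for all a, b ∈ X, where c > 0 and K ≥ 1 are constants. Then for all Borel probability measures μ, ν on X, the first Wasserstein distances satisfy d_W(π_*μ, π_*ν) ≥ c · ( d_W(μ, ν) )^K, where π_*μ denotes the pushforward of μ under π. -/

import Mathlib

open MeasureTheory Filter Set

/-- The first Wasserstein distance between two Borel probability measures on a metric
space: the infimum of `∫ d(x,y) dP` over all couplings `P` of the two measures. -/
noncomputable def wassersteinDist {M : Type*} [MetricSpace M] [MeasurableSpace M]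
    (μ ν : Measure M) : ℝ :=
  sInf { r : ℝ | ∃ P : Measure (M × M), IsProbabilityMeasure P ∧
    P.map Prod.fst = μ ∧ P.map Prod.snd = ν ∧ r = ∫ p, dist p.1 p.2 ∂P }

/-- The cost of any coupling bounds the Wasserstein distance from above. -/
theorem wassersteinDist_le {M : Type*} [MetricSpace M] [MeasurableSpace M]
    (P : Measure (M × M)) [IsProbabilityMeasure P] :
    wassersteinDist (P.map Prod.fst) (P.map Prod.snd) ≤ ∫ p, dist p.1 p.2 ∂P := by
  refine csInf_le ⟨0, ?_⟩ ⟨P, inferInstance, rfl, rfl, rfl⟩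
  rintro _ ⟨_, _, _, _, rfl⟩
  exact integral_nonneg fun _ => dist_nonneg

theorem wassersteinDist_nonneg {M : Type*} [MetricSpace M] [MeasurableSpace M]
    (μ ν : Measure M) : 0 ≤ wassersteinDist μ ν := by
  refine Real.sInf_nonneg ?_
  rintro _ ⟨_, _, _, _, rfl⟩
  exact integral_nonneg fun _ => dist_nonneg

/-- A lower bound for the cost of every coupling is a lower bound for the distance. -/
theorem le_wassersteinDist {M : Type*} [MetricSpace M] [MeasurableSpace M]
    {μ ν : Measure M} [IsProbabilityMeasure μ] [IsProbabilityMeasure ν] {r : ℝ}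
    (h : ∀ P : Measure (M × M), IsProbabilityMeasure P → P.map Prod.fst = μ →
      P.map Prod.snd = ν → r ≤ ∫ p, dist p.1 p.2 ∂P) :
    r ≤ wassersteinDist μ ν := by
  refine le_csInf ⟨_, μ.prod ν, inferInstance, ?_, ?_, rfl⟩ ?_
  · simp [Measure.map_fst_prod]
  · simp [Measure.map_snd_prod]
  · rintro _ ⟨P, hP, h₁, h₂, rfl⟩
    exact h P hP h₁ h₂

/-- Jensen's inequality for the power `K ≥ 1` of a nonnegative continuous function on a
compact space. -/
theorem rpow_integral_le_integral_rpow {Z : Type*} [TopologicalSpace Z] [CompactSpace Z]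
    [MeasurableSpace Z] [OpensMeasurableSpace Z] (Q : Measure Z) [IsProbabilityMeasure Q]
    {f : Z → ℝ} (hf : Continuous f) (hf₀ : ∀ z, 0 ≤ f z) {K : ℝ} (hK : 1 ≤ K) :
    (∫ z, f z ∂Q) ^ K ≤ ∫ z, f z ^ K ∂Q := by
  have hpow : Continuous fun x : ℝ => x ^ K :=
    Real.continuous_rpow_const (zero_le_one.trans hK)
  exact (convexOn_rpow hK).map_integral_le hpow.continuousOn isClosed_Ici
    (ae_of_all _ hf₀)
    (hf.integrable_of_hasCompactSupport (HasCompactSupport.of_compactSpace _))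
    ((hpow.comp hf).integrable_of_hasCompactSupport (HasCompactSupport.of_compactSpace _))

/-- Let `X`, `Y` be compact metric spaces and `π : X → Y` a homeomorphism
with `d(π a, π b) ≥ c · d(a,b)^K` for all `a, b`, where `c > 0` and `K ≥ 1`. Then for all
Borel probability measures `μ, ν` on `X`,
`d_W(π_*μ, π_*ν) ≥ c · (d_W(μ, ν))^K`. -/
theorem wasserstein_pushforward_lower_bound
    {X Y : Type*} [MetricSpace X] [CompactSpace X] [MeasurableSpace X] [BorelSpace X]
    [MetricSpace Y] [CompactSpace Y] [MeasurableSpace Y] [BorelSpace Y]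
    (π : X ≃ₜ Y) (c K : ℝ) (hc : 0 < c) (hK : 1 ≤ K)
    (hdist : ∀ a b : X, c * dist a b ^ K ≤ dist (π a) (π b))
    (μ ν : Measure X) (hμ : IsProbabilityMeasure μ) (hν : IsProbabilityMeasure ν) :
    c * wassersteinDist μ ν ^ K ≤ wassersteinDist (μ.map π) (ν.map π) := by
  have hK₀ : 0 ≤ K := zero_le_one.trans hK
  have := Measure.isProbabilityMeasure_map (μ := μ) π.continuous.aemeasurable
  have := Measure.isProbabilityMeasure_map (μ := ν) π.continuous.aemeasurable
  refine le_wassersteinDist fun P hP h₁ h₂ => ?_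
  have hφ : Measurable (Prod.map π.symm π.symm) :=
    π.symm.measurable.prodMap π.symm.measurable
  set Q : Measure (X × X) := P.map (Prod.map π.symm π.symm) with hQ
  have : IsProbabilityMeasure Q := Measure.isProbabilityMeasure_map hφ.aemeasurable
  have hQ₁ : Q.map Prod.fst = μ := by
    rw [hQ, Measure.map_map measurable_fst hφ, Prod.map_fst',
      ← Measure.map_map π.symm.measurable measurable_fst, h₁,
      Measure.map_map π.symm.measurable π.measurable, π.symm_comp_self, Measure.map_id]
  have hQ₂ : Q.map Prod.snd = ν := by
    rw [hQ, Measure.map_map measurable_snd hφ, Prod.map_snd',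
      ← Measure.map_map π.symm.measurable measurable_snd, h₂,
      Measure.map_map π.symm.measurable π.measurable, π.symm_comp_self, Measure.map_id]
  have hW : wassersteinDist μ ν ≤ ∫ p, dist p.1 p.2 ∂Q := by
    simpa only [hQ₁, hQ₂] using wassersteinDist_le Q
  have hcont : Continuous fun p : X × X => dist (π p.1) (π p.2) := by fun_prop
  have hpow : Continuous fun p : X × X => c * dist p.1 p.2 ^ K :=
    continuous_const.mul (continuous_dist.rpow_const fun _ => Or.inr hK₀)
  calc c * wassersteinDist μ ν ^ K
      ≤ c * (∫ p, dist p.1 p.2 ∂Q) ^ K := by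
        gcongr
        exact wassersteinDist_nonneg μ ν
    _ ≤ c * ∫ p, dist p.1 p.2 ^ K ∂Q := by
        gcongr
        exact rpow_integral_le_integral_rpow Q continuous_dist (fun _ => dist_nonneg) hK
    _ = ∫ p, c * dist p.1 p.2 ^ K ∂Q := (integral_const_mul _ _).symm
    _ ≤ ∫ p, dist (π p.1) (π p.2) ∂Q :=
        integral_mono
          (hpow.integrable_of_hasCompactSupport (HasCompactSupport.of_compactSpace _))
          (hcont.integrable_of_hasCompactSupport (HasCompactSupport.of_compactSpace _))
          fun p => hdist p.1 p.2
    _ = ∫ p, dist p.1 p.2 ∂P := by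
        rw [hQ, integral_map hφ.aemeasurable hcont.aestronglyMeasurable]
        simp
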